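/- arXiv:1508.05034 — 2 statements merged into one kernel-verified Lean document; each statement's English description precedes it below -/
import Mathlib

section
/- If the protocol ẋ(t) = −L[A(t)]x(t) establishes bipartite consensus, i.e. there exist v ∈ ℝ^N \ {0} and ρ ∈ {−1,+1}^N such that every solution satisfies lim_{t→∞} x(t) = ρ(vᵀ x(0)), then the time-varying graph G[A(·)] is essentially quasi-strongly connected: the directed graph on {1,…,N} with an arc from k to j whenever ∫_0^∞ |a_{jk}(t)|dt = ∞ has a root (a node with a directed path to every other node). -/
open MeasureTheory Filter Matrix Finset Topology

/-- The signed Laplacian `L[A]` of a signed adjacency matrix: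
off-diagonal entries `L j k = -A j k`, diagonal entries `L j j = ∑ m, |A j m|`. -/
noncomputable def sLap {N : ℕ} (A : Matrix (Fin N) (Fin N) ℝ) : Matrix (Fin N) (Fin N) ℝ :=
  fun j k => if j = k then ∑ m, |A j m| else -A j k

/-- A time-varying signed adjacency matrix: entrywise measurable, locally bounded,
with zero diagonal. -/
def IsAdjacency {N : ℕ} (A : ℝ → Matrix (Fin N) (Fin N) ℝ) : Prop :=
  (∀ j k, Measurable fun t => A t j k) ∧
  (∀ T : ℝ, ∃ C : ℝ, ∀ t ∈ Set.Icc (0:ℝ) T, ∀ j k, |A t j k| ≤ C) ∧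
  (∀ t j, A t j j = 0)

/-- A solution of `ẋ = −L[A(t)]x` on `[0,∞)`: continuous and satisfying the integral
equation (equivalently, locally absolutely continuous and satisfying the ODE a.e.). -/
def IsSolution {N : ℕ} (A : ℝ → Matrix (Fin N) (Fin N) ℝ) (x : ℝ → Fin N → ℝ) : Prop :=
  ContinuousOn x (Set.Ici 0) ∧
  ∀ t ∈ Set.Ici (0:ℝ), ∀ j,
    x t j = x 0 j + ∫ s in (0:ℝ)..t, -((sLap (A s)).mulVec (x s) j)

/-- Quasi-strong connectivity of the static signed graph `G[A]`: some root reaches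
every node along arcs `k → j` present whenever `A j k ≠ 0`. -/
def QSC {N : ℕ} (A : Matrix (Fin N) (Fin N) ℝ) : Prop :=
  ∃ r : Fin N, ∀ j : Fin N, Relation.ReflTransGen (fun k j => A j k ≠ 0) r j

/-- Structural balance of the static signed graph `G[A]`: the nodes split into the camp `S`
and its complement (one possibly empty), with nonnegative weights inside a camp and
nonpositive weights between camps. -/
def StructBal {N : ℕ} (A : Matrix (Fin N) (Fin N) ℝ) : Prop :=
  ∃ S : Set (Fin N), ∀ j k : Fin N,
    ((j ∈ S ↔ k ∈ S) → 0 ≤ A j k) ∧ (¬(j ∈ S ↔ k ∈ S) → A j k ≤ 0)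

/-- `∫_0^∞ |a_{jk}(t)| dt = ∞`: arc `k → j` of the graph of essential interactions. -/
def EssArc {N : ℕ} (A : ℝ → Matrix (Fin N) (Fin N) ℝ) (j k : Fin N) : Prop :=
  ∫⁻ t in Set.Ici (0:ℝ), ENNReal.ofReal |A t j k| = ⊤

/-- `∫_0^∞ a_{jk}⁺(t) dt = ∞`: agents `j` and `k` essentially cooperate. -/
def EssPlus {N : ℕ} (A : ℝ → Matrix (Fin N) (Fin N) ℝ) (j k : Fin N) : Prop :=
  ∫⁻ t in Set.Ici (0:ℝ), ENNReal.ofReal (max (A t j k) 0) = ⊤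

/-- `∫_0^∞ a_{jk}⁻(t) dt = ∞`: agents `j` and `k` essentially compete. -/
def EssMinus {N : ℕ} (A : ℝ → Matrix (Fin N) (Fin N) ℝ) (j k : Fin N) : Prop :=
  ∫⁻ t in Set.Ici (0:ℝ), ENNReal.ofReal (max (-(A t j k)) 0) = ⊤

/-- Reachability from `u` to `v` in the graph of essential interactions. -/
def EssReach {N : ℕ} (A : ℝ → Matrix (Fin N) (Fin N) ℝ) (u v : Fin N) : Prop :=
  Relation.ReflTransGen (fun k j => EssArc A j k) u v

/-- Uniform strong connectivity of the time-varying graph `G[A(·)]`. -/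
def USC {N : ℕ} (A : ℝ → Matrix (Fin N) (Fin N) ℝ) : Prop :=
  ∃ T > (0:ℝ), ∃ ε > (0:ℝ), ∀ t ≥ (0:ℝ), ∀ u v : Fin N,
    Relation.ReflTransGen (fun k j => ε ≤ ∫ s in t..(t + T), |A s j k|) u v

/-- Uniform quasi-strong connectivity of the time-varying graph `G[A(·)]`. -/
def UQSC {N : ℕ} (A : ℝ → Matrix (Fin N) (Fin N) ℝ) : Prop :=
  ∃ T > (0:ℝ), ∃ ε > (0:ℝ), ∀ t ≥ (0:ℝ), ∃ r : Fin N, ∀ j : Fin N,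
    Relation.ReflTransGen (fun k j => ε ≤ ∫ s in t..(t + T), |A s j k|) r j

/-- Cut-balance of the time-varying graph `G[A(·)]` with some constant `K ≥ 1`. -/
def CutBalanced {N : ℕ} (A : ℝ → Matrix (Fin N) (Fin N) ℝ) : Prop :=
  ∃ K : ℝ, 1 ≤ K ∧ ∀ᵐ t ∂(volume.restrict (Set.Ici (0:ℝ))),
    ∀ V : Finset (Fin N), V.Nonempty → V ≠ Finset.univ →
      K⁻¹ * (∑ j ∈ V, ∑ k ∈ Vᶜ, |A t k j|) ≤ (∑ j ∈ V, ∑ k ∈ Vᶜ, |A t j k|) ∧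
      (∑ j ∈ V, ∑ k ∈ Vᶜ, |A t j k|) ≤ K * (∑ j ∈ V, ∑ k ∈ Vᶜ, |A t k j|)

/-- The protocol establishes modulus consensus: the moduli of all opinions converge
to a common limit for every solution. -/
def ModulusConsensus {N : ℕ} (A : ℝ → Matrix (Fin N) (Fin N) ℝ) : Prop :=
  ∀ x : ℝ → Fin N → ℝ, IsSolution A x →
    ∃ c : ℝ, 0 ≤ c ∧ ∀ i, Tendsto (fun t => |x t i|) atTop (𝓝 c)

/-- The protocol establishes bipartite consensus: there are `v ≠ 0` and `ρ ∈ {±1}^N` such that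
every solution converges to `ρ (vᵀ x(0))`. -/
def BipartiteConsensus {N : ℕ} (A : ℝ → Matrix (Fin N) (Fin N) ℝ) : Prop :=
  ∃ v ρ : Fin N → ℝ, v ≠ 0 ∧ (∀ i, ρ i = 1 ∨ ρ i = -1) ∧
    ∀ x : ℝ → Fin N → ℝ, IsSolution A x →
      ∀ i, Tendsto (fun t => x t i) atTop (𝓝 (ρ i * ∑ j, v j * x 0 j))

/-- The essential-interaction signed graph `𝒢^±` is structurally balanced: the camp `S` and
its complement contain all essentially-cooperating pairs inside a camp and all
essentially-competing pairs between the camps. -/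
def EssStructBal {N : ℕ} (A : ℝ → Matrix (Fin N) (Fin N) ℝ) : Prop :=
  ∃ S : Set (Fin N),
    (∀ j k, EssPlus A j k → (j ∈ S ↔ k ∈ S)) ∧
    (∀ j k, EssMinus A j k → ¬(j ∈ S ↔ k ∈ S))

/-- A Carathéodory equation that is Lipschitz in space and vanishes at `0`, posed on the
whole line, is solvable from any initial time: contraction in the supremum norm weighted by
`cosh (2 ∫ b)`. -/
theorem exists_caratheodory_solution {E : Type*} [NormedAddCommGroup E] [NormedSpace ℝ E]
    [CompleteSpace E] (B : ℝ → E → E) (b : ℝ → ℝ) (hb : Continuous b) (hb0 : ∀ t, 0 ≤ b t)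
    (hLip : ∀ t u w, ‖B t u - B t w‖ ≤ b t * ‖u - w‖) (hzero : ∀ t, B t 0 = 0)
    (hmeas : ∀ u : ℝ → E, Continuous u → AEStronglyMeasurable (fun t => B t (u t)) volume)
    (t₀ : ℝ) (x₀ : E) :
    ∃ x : ℝ → E, Continuous x ∧ x t₀ = x₀ ∧ ∀ a c, x c = x a + ∫ s in a..c, B s (x s) := by
  have hint : ∀ u : ℝ → E, Continuous u → ∀ a c,
      IntervalIntegrable (fun s => B s (u s)) volume a c := by
    intro u hu a c
    refine ((hb.mul hu.norm).intervalIntegrable a c).mono_fun' (hmeas u hu).restrict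
      (Eventually.of_forall fun s => ?_)
    simpa [hzero] using hLip s (u s) 0
  set G : ℝ → ℝ := fun t => ∫ s in t₀..t, b s with hG
  have hGd : ∀ t, HasDerivAt G (b t) t := fun t =>
    intervalIntegral.integral_hasDerivAt_right (hb.intervalIntegrable _ _)
      hb.stronglyMeasurable.stronglyMeasurableAtFilter hb.continuousAt
  have hGc : Continuous G := continuous_iff_continuousAt.2 fun t => (hGd t).continuousAt
  set W : ℝ → ℝ := fun t => Real.cosh (2 * G t) with hW
  have hWc : Continuous W := Real.continuous_cosh.comp (hGc.const_mul 2)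
  have hW1 : ∀ t, 1 ≤ W t := fun t => Real.one_le_cosh _
  have hWpos : ∀ t, 0 < W t := fun t => lt_of_lt_of_le one_pos (hW1 t)
  have hbW : ∀ t, |∫ s in t₀..t, b s * W s| ≤ W t / 2 := by
    intro t
    have h : ∫ s in t₀..t, b s * W s = Real.sinh (2 * G t) / 2 - Real.sinh (2 * G t₀) / 2 := by
      refine intervalIntegral.integral_eq_sub_of_hasDerivAt
        (f := fun t => Real.sinh (2 * G t) / 2) (fun s _ => ?_)
        ((hb.mul hWc).intervalIntegrable _ _)
      refine ((((hGd s).const_mul 2).sinh).div_const 2).congr_deriv ?_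
      change Real.cosh (2 * G s) * (2 * b s) / 2 = b s * Real.cosh (2 * G s)
      ring
    have h0 : G t₀ = 0 := by simp [hG]
    rw [h, h0]
    simp only [mul_zero, Real.sinh_zero, zero_div, sub_zero, abs_div, abs_two]
    have : |Real.sinh (2 * G t)| ≤ W t := by
      rw [Real.abs_sinh]
      simp only [hW]
      rw [← Real.cosh_abs (2 * G t)]
      exact (Real.sinh_lt_cosh _).le
    linarith
  have hdiff : ∀ u w : ℝ → E, Continuous u → Continuous w → ∀ d : ℝ,
      (∀ s, ‖u s - w s‖ ≤ d * W s) → ∀ t,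
      ‖(∫ s in t₀..t, B s (u s)) - ∫ s in t₀..t, B s (w s)‖ ≤ d * (W t / 2) := by
    intro u w hu hw d hd t
    have hd0 : 0 ≤ d := by
      have := (norm_nonneg _).trans (hd 0)
      exact nonneg_of_mul_nonneg_left this (hWpos 0)
    have hbd : ∀ s, b s * ‖u s - w s‖ ≤ d * (b s * W s) := by
      intro s
      calc b s * ‖u s - w s‖ ≤ b s * (d * W s) := mul_le_mul_of_nonneg_left (hd s) (hb0 s)
        _ = _ := by ring
    rw [← intervalIntegral.integral_sub (hint u hu _ _) (hint w hw _ _)]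
    calc _ ≤ |∫ s in t₀..t, d * (b s * W s)| := by
          refine intervalIntegral.norm_integral_le_abs_of_norm_le
            (Eventually.of_forall fun s => (hLip s _ _).trans (hbd s))
            (((hb.mul hWc).const_mul d).intervalIntegrable _ _)
      _ = d * |∫ s in t₀..t, b s * W s| := by
          rw [intervalIntegral.integral_const_mul, abs_mul, abs_of_nonneg hd0]
      _ ≤ _ := mul_le_mul_of_nonneg_left (hbW t) hd0
  have hprim : ∀ u : ℝ → E, Continuous u → Continuous fun t => ∫ s in t₀..t, B s (u s) :=
    fun u hu => intervalIntegral.continuous_primitive (hint u hu) t₀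
  have hlift : ∀ y : BoundedContinuousFunction ℝ E, Continuous fun s => W s • y s :=
    fun y => hWc.smul y.continuous
  let Φ : BoundedContinuousFunction ℝ E → BoundedContinuousFunction ℝ E := fun y =>
    BoundedContinuousFunction.ofNormedAddCommGroup
      (fun t => (W t)⁻¹ • (x₀ + ∫ s in t₀..t, B s (W s • y s)))
      ((hWc.inv₀ fun t => (hWpos t).ne').smul (continuous_const.add (hprim _ (hlift y))))
      (‖x₀‖ + ‖y‖ / 2) (by
        intro t
        have h := hdiff _ (fun _ => 0) (hlift y) continuous_const ‖y‖ (fun s => by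
          rw [sub_zero, norm_smul, Real.norm_of_nonneg (hWpos s).le, mul_comm]
          exact mul_le_mul_of_nonneg_right (y.norm_coe_le_norm s) (hWpos s).le) t
        simp only [hzero, intervalIntegral.integral_zero, sub_zero] at h
        rw [norm_smul, norm_inv, Real.norm_of_nonneg (hWpos t).le, inv_mul_le_iff₀ (hWpos t)]
        have h1 := norm_add_le x₀ (∫ s in t₀..t, B s (W s • y s))
        nlinarith [norm_nonneg x₀, hW1 t])
  have hΦ : ContractingWith (1 / 2) Φ := by
    refine ⟨by rw [← NNReal.coe_lt_coe]; norm_num, LipschitzWith.of_dist_le_mul fun y z => ?_⟩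
    rw [BoundedContinuousFunction.dist_le (by positivity)]
    intro t
    have h := hdiff _ _ (hlift y) (hlift z) (dist y z) (fun s => by
      rw [← smul_sub, norm_smul, Real.norm_of_nonneg (hWpos s).le, mul_comm, ← dist_eq_norm]
      exact mul_le_mul_of_nonneg_right (y.dist_coe_le_dist s) (hWpos s).le) t
    simp only [Φ, BoundedContinuousFunction.coe_ofNormedAddCommGroup, dist_eq_norm (_ : E)]
    rw [← smul_sub, add_sub_add_left_eq_sub, norm_smul, norm_inv,
      Real.norm_of_nonneg (hWpos t).le, inv_mul_le_iff₀ (hWpos t)]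
    refine h.trans (le_of_eq ?_)
    push_cast
    ring
  set y := ContractingWith.fixedPoint Φ hΦ
  have hy : Φ y = y := hΦ.fixedPoint_isFixedPt
  have hx : ∀ t, W t • y t = x₀ + ∫ s in t₀..t, B s (W s • y s) := by
    intro t
    have h : (Φ y) t = y t := by rw [hy]
    simp only [Φ, BoundedContinuousFunction.coe_ofNormedAddCommGroup] at h
    rw [← h, smul_inv_smul₀ (hWpos t).ne']
  refine ⟨fun t => W t • y t, hlift y, by simpa using hx t₀, fun a c => ?_⟩
  simp only
  rw [hx a, hx c, add_assoc, intervalIntegral.integral_add_adjacent_intervals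
    (hint _ (hlift y) _ _) (hint _ (hlift y) _ _)]

theorem sLap_mulVec {N : ℕ} (A : Matrix (Fin N) (Fin N) ℝ) (hA : ∀ j, A j j = 0)
    (w : Fin N → ℝ) (j : Fin N) :
    (sLap A).mulVec w j = (∑ m, |A j m|) * w j - ∑ k, A j k * w k := by
  have h : ∀ k, sLap A j k * w k =
      (if j = k then (∑ m, |A j m|) * w k else 0) - A j k * w k := by
    intro k
    by_cases hjk : j = k
    · subst hjk
      simp [sLap, hA]
    · simp [sLap, hjk]
  simp only [Matrix.mulVec, dotProduct, h, Finset.sum_sub_distrib]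
  simp

theorem abs_sLap_mulVec_le {N : ℕ} (A : Matrix (Fin N) (Fin N) ℝ) (hA : ∀ j, A j j = 0)
    {C : ℝ} (hC : ∀ j k, |A j k| ≤ C) (w : Fin N → ℝ) (j : Fin N) :
    |(sLap A).mulVec w j| ≤ 2 * N * C * ‖w‖ := by
  have hd : ∑ m, |A j m| ≤ N * C := by
    simpa using Finset.sum_le_card_nsmul univ (fun m => |A j m|) C fun m _ => hC j m
  have hd0 : 0 ≤ ∑ m, |A j m| := Finset.sum_nonneg fun m _ => abs_nonneg _
  have hw : ∀ k, |w k| ≤ ‖w‖ := fun k => norm_le_pi_norm w k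
  have h1 : |(∑ m, |A j m|) * w j| ≤ N * C * ‖w‖ := by
    rw [abs_mul, abs_of_nonneg hd0]
    exact mul_le_mul hd (hw j) (abs_nonneg _) (hd0.trans hd)
  have h2 : |∑ k, A j k * w k| ≤ N * C * ‖w‖ := by
    calc |∑ k, A j k * w k| ≤ ∑ k, |A j k| * ‖w‖ := by
          refine (Finset.abs_sum_le_sum_abs _ _).trans (Finset.sum_le_sum fun k _ => ?_)
          rw [abs_mul]
          exact mul_le_mul_of_nonneg_left (hw k) (abs_nonneg _)
      _ ≤ _ := by
          rw [← Finset.sum_mul]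
          exact mul_le_mul_of_nonneg_right hd (norm_nonneg _)
  rw [sLap_mulVec A hA]
  refine (abs_sub _ _).trans ?_
  linarith

theorem measurable_sLap {N : ℕ} {A : ℝ → Matrix (Fin N) (Fin N) ℝ}
    (hA : ∀ j k, Measurable fun t => A t j k) (j k : Fin N) :
    Measurable fun t => sLap (A t) j k := by
  unfold sLap
  by_cases h : j = k
  · simp only [h, if_true]
    exact Finset.measurable_sum _ fun m _ => (hA k m).norm
  · simp only [h, if_false]
    exact (hA j k).neg

theorem IsAdjacency.exists_continuous_bound {N : ℕ} {A : ℝ → Matrix (Fin N) (Fin N) ℝ}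
    (hA : IsAdjacency A) :
    ∃ g : ℝ → ℝ, Continuous g ∧ ∀ t, 0 ≤ g t ∧ ∀ j k, |A (max t 0) j k| ≤ g t := by
  obtain ⟨g, hg⟩ := exists_continuous_forall_mem_convex_of_local_const
    (t := fun t : ℝ => {c : ℝ | 0 ≤ c ∧ ∀ j k, |A (max t 0) j k| ≤ c}) (fun t => by
      refine Set.OrdConnected.convex ⟨fun c hc d _ e he => ?_⟩
      exact ⟨hc.1.trans he.1, fun j k => (hc.2 j k).trans he.1⟩) (fun t => by
      obtain ⟨C, hC⟩ := hA.2.1 (max (t + 1) 0)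
      refine ⟨max C 0, ?_⟩
      filter_upwards [eventually_lt_nhds (lt_add_one t)] with s hs
      exact ⟨le_max_right _ _, fun j k => (hC _ ⟨le_max_right _ _,
        max_le_max hs.le le_rfl⟩ j k).trans (le_max_left _ _)⟩)
  exact ⟨g, g.continuous, hg⟩

theorem IsAdjacency.exists_isSolution {N : ℕ} {A : ℝ → Matrix (Fin N) (Fin N) ℝ}
    (hA : IsAdjacency A) {t₀ : ℝ} (x₀ : Fin N → ℝ) :
    ∃ x : ℝ → Fin N → ℝ, IsSolution A x ∧ x t₀ = x₀ := by
  obtain ⟨g, hgc, hg⟩ := hA.exists_continuous_bound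
  let B : ℝ → (Fin N → ℝ) → Fin N → ℝ := fun t u => -((sLap (A (max t 0))).mulVec u)
  have hbound : ∀ t u, ‖B t u‖ ≤ 2 * N * g t * ‖u‖ := by
    intro t u
    have h0 : 0 ≤ 2 * N * g t * ‖u‖ :=
      mul_nonneg (mul_nonneg (by positivity) (hg t).1) (norm_nonneg _)
    rw [pi_norm_le_iff_of_nonneg h0]
    intro j
    simp only [B, Pi.neg_apply, norm_neg, Real.norm_eq_abs]
    exact abs_sLap_mulVec_le _ (hA.2.2 _) (hg t).2 u j
  have hmeas : ∀ u : ℝ → Fin N → ℝ, Continuous u → Measurable fun t => B t (u t) := by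
    intro u hu
    refine measurable_pi_iff.2 fun j => ?_
    simp only [B, Pi.neg_apply, Matrix.mulVec, dotProduct]
    refine (Finset.measurable_sum _ fun k _ => ?_).neg
    exact (measurable_sLap (A := fun t => A (max t 0))
      (fun j k => (hA.1 j k).comp (measurable_id.max measurable_const)) j k).mul
      ((continuous_apply k).comp hu).measurable
  obtain ⟨x, hxc, hx0, hx⟩ := exists_caratheodory_solution B (fun t => 2 * N * g t)
    (continuous_const.mul hgc) (fun t => mul_nonneg (by positivity) (hg t).1)
    (fun t u w => by
      have h := hbound t (u - w)
      simpa only [B, Matrix.mulVec_sub, neg_sub, sub_neg_eq_add, neg_add_eq_sub] using h)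
    (fun t => by simp [B]) (fun u hu => (hmeas u hu).aestronglyMeasurable) t₀ x₀
  refine ⟨x, ⟨hxc.continuousOn, fun t ht j => ?_⟩, hx0⟩
  have hint : IntervalIntegrable (fun s => B s (x s)) volume 0 t :=
    ((((continuous_const.mul hgc).mul hxc.norm)).intervalIntegrable 0 t).mono_fun'
      (hmeas x hxc).aestronglyMeasurable (Eventually.of_forall fun s => hbound s (x s))
  have h := congrFun (hx 0 t) j
  rw [Pi.add_apply] at h
  rw [h]
  congr 1
  rw [← ContinuousLinearMap.proj_apply (R := ℝ) (φ := fun _ : Fin N => ℝ) j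
    (∫ s in (0:ℝ)..t, B s (x s)), ← ContinuousLinearMap.intervalIntegral_comp_comm _ hint]
  refine intervalIntegral.integral_congr fun s hs => ?_
  rw [Set.uIcc_of_le ht] at hs
  simp [B, max_eq_left hs.1]

theorem IsAdjacency.intervalIntegrable {N : ℕ} {A : ℝ → Matrix (Fin N) (Fin N) ℝ}
    (hA : IsAdjacency A) (j k : Fin N) {a b : ℝ} (ha : 0 ≤ a) (hb : 0 ≤ b) :
    IntervalIntegrable (fun t => A t j k) volume a b := by
  obtain ⟨C, hC⟩ := hA.2.1 (max a b)
  refine (intervalIntegrable_const (c := C)).mono_fun'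
    (hA.1 j k).aestronglyMeasurable ?_
  refine (ae_restrict_iff' measurableSet_uIoc).2 (Eventually.of_forall fun s hs => ?_)
  exact hC s ⟨(le_min ha hb).trans hs.1.le, hs.2⟩ j k

theorem IsSolution.intervalIntegrable {N : ℕ} {A : ℝ → Matrix (Fin N) (Fin N) ℝ}
    (hA : IsAdjacency A) {x : ℝ → Fin N → ℝ} (hx : IsSolution A x) (j : Fin N) {a b : ℝ}
    (ha : 0 ≤ a) (hb : 0 ≤ b) :
    IntervalIntegrable (fun s => -((sLap (A s)).mulVec (x s) j)) volume a b := by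
  have hsub : Set.uIcc a b ⊆ Set.Ici 0 := fun s hs => (le_min ha hb).trans hs.1
  have hxk : ∀ k, ContinuousOn (fun s => x s k) (Set.uIcc a b) := fun k =>
    (continuous_apply k).comp_continuousOn (hx.1.mono hsub)
  have hsum : ∀ f : Fin N → ℝ → ℝ, (∀ k, IntervalIntegrable (f k) volume a b) →
      IntervalIntegrable (fun s => ∑ k, f k s) volume a b := fun f hf => by
    simpa only [Finset.sum_fn] using IntervalIntegrable.sum univ fun k _ => hf k
  simp only [sLap_mulVec _ (hA.2.2 _)]
  exact (((hsum _ fun k => (hA.intervalIntegrable j k ha hb).abs).mul_continuousOn (hxk j)).sub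
    (hsum _ fun k => (hA.intervalIntegrable j k ha hb).mul_continuousOn (hxk k))).neg

theorem IsSolution.eq_add_integral {N : ℕ} {A : ℝ → Matrix (Fin N) (Fin N) ℝ}
    (hA : IsAdjacency A) {x : ℝ → Fin N → ℝ} (hx : IsSolution A x) (j : Fin N) {a b : ℝ}
    (ha : 0 ≤ a) (hb : 0 ≤ b) :
    x b j = x a j + ∫ s in a..b, -((sLap (A s)).mulVec (x s) j) := by
  rw [hx.2 a ha j, hx.2 b hb j, add_assoc, intervalIntegral.integral_add_adjacent_intervals
    (hx.intervalIntegrable hA j le_rfl ha) (hx.intervalIntegrable hA j ha hb)]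

theorem IsSolution.add {N : ℕ} {A : ℝ → Matrix (Fin N) (Fin N) ℝ}
    (hA : IsAdjacency A) {x y : ℝ → Fin N → ℝ} (hx : IsSolution A x) (hy : IsSolution A y) :
    IsSolution A (x + y) := by
  refine ⟨hx.1.add hy.1, fun t ht j => ?_⟩
  simp only [Pi.add_apply, Matrix.mulVec_add, neg_add]
  rw [intervalIntegral.integral_add (hx.intervalIntegrable hA j le_rfl ht)
    (hy.intervalIntegrable hA j le_rfl ht), hx.2 t ht j, hy.2 t ht j]
  ring

theorem IsSolution.neg {N : ℕ} {A : ℝ → Matrix (Fin N) (Fin N) ℝ} {x : ℝ → Fin N → ℝ}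
    (hx : IsSolution A x) : IsSolution A (-x) := by
  refine ⟨hx.1.neg, fun t ht j => ?_⟩
  simp only [Pi.neg_apply, Matrix.mulVec_neg, intervalIntegral.integral_neg]
  rw [hx.2 t ht j, intervalIntegral.integral_neg]
  ring

/-- Total weight of the arcs entering `S` from outside. -/
def inWeight {N : ℕ} (A : Matrix (Fin N) (Fin N) ℝ) (S : Finset (Fin N)) : ℝ :=
  ∑ j ∈ S, ∑ k ∈ Sᶜ, |A j k|

theorem inWeight_nonneg {N : ℕ} (A : Matrix (Fin N) (Fin N) ℝ) (S : Finset (Fin N)) :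
    0 ≤ inWeight A S :=
  Finset.sum_nonneg fun _ _ => Finset.sum_nonneg fun _ _ => abs_nonneg _

theorem IsAdjacency.intervalIntegrable_inWeight {N : ℕ} {A : ℝ → Matrix (Fin N) (Fin N) ℝ}
    (hA : IsAdjacency A) (S : Finset (Fin N)) {a b : ℝ} (ha : 0 ≤ a) (hb : 0 ≤ b) :
    IntervalIntegrable (fun t => inWeight (A t) S) volume a b := by
  have h : (fun t => inWeight (A t) S) = ∑ j ∈ S, ∑ k ∈ Sᶜ, fun t => |A t j k| := by
    ext t
    simp [inWeight, Finset.sum_apply]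
  rw [h]
  exact IntervalIntegrable.sum _ fun j _ => IntervalIntegrable.sum _ fun k _ =>
    (hA.intervalIntegrable j k ha hb).abs

theorem abs_sub_sLap_mulVec_le {N : ℕ} (A : Matrix (Fin N) (Fin N) ℝ) (hA : ∀ j, A j j = 0)
    {C M : ℝ} (hC : ∀ j k, |A j k| ≤ C) {S : Finset (Fin N)} {j : Fin N} (hj : j ∈ S)
    (u : Fin N → ℝ) (hM : ‖u‖ ≤ M) :
    |N * C * u j - (sLap A).mulVec u j| ≤
      N * C * ‖S.piecewise u 0‖ + M * inWeight A S := by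
  set p := ‖S.piecewise u 0‖
  have hp : ∀ k ∈ S, |u k| ≤ p := fun k hk => by
    simpa [Finset.piecewise_eq_of_mem _ _ _ hk] using norm_le_pi_norm (S.piecewise u 0) k
  have hd : ∑ m, |A j m| ≤ N * C := by
    simpa using Finset.sum_le_card_nsmul univ (fun m => |A j m|) C fun m _ => hC j m
  have hsplit := Finset.sum_add_sum_compl S fun m => |A j m|
  have h1 : |(N * C - ∑ m, |A j m|) * u j| ≤ (N * C - ∑ m, |A j m|) * p := by
    rw [abs_mul, abs_of_nonneg (sub_nonneg.2 hd)]
    exact mul_le_mul_of_nonneg_left (hp j hj) (sub_nonneg.2 hd)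
  have h2 : |∑ k ∈ S, A j k * u k| ≤ (∑ k ∈ S, |A j k|) * p := by
    rw [Finset.sum_mul]
    refine (Finset.abs_sum_le_sum_abs _ _).trans (Finset.sum_le_sum fun k hk => ?_)
    rw [abs_mul]
    exact mul_le_mul_of_nonneg_left (hp k hk) (abs_nonneg _)
  have h3 : |∑ k ∈ Sᶜ, A j k * u k| ≤ (∑ k ∈ Sᶜ, |A j k|) * M := by
    rw [Finset.sum_mul]
    refine (Finset.abs_sum_le_sum_abs _ _).trans (Finset.sum_le_sum fun k hk => ?_)
    rw [abs_mul]
    exact mul_le_mul_of_nonneg_left ((norm_le_pi_norm u k).trans hM) (abs_nonneg _)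
  have h4 : ∑ k ∈ Sᶜ, |A j k| ≤ inWeight A S :=
    Finset.single_le_sum (f := fun j => ∑ k ∈ Sᶜ, |A j k|)
      (fun _ _ => Finset.sum_nonneg fun _ _ => abs_nonneg _) hj
  have h5 := mul_le_mul_of_nonneg_right h4 ((norm_nonneg u).trans hM)
  have h6 : 0 ≤ (∑ k ∈ Sᶜ, |A j k|) * p :=
    mul_nonneg (Finset.sum_nonneg fun _ _ => abs_nonneg _) (norm_nonneg _)
  have heq : N * C * u j - (sLap A).mulVec u j = (N * C - ∑ m, |A j m|) * u j +
      (∑ k ∈ S, A j k * u k + ∑ k ∈ Sᶜ, A j k * u k) := by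
    rw [sLap_mulVec A hA, Finset.sum_add_sum_compl]
    ring
  rw [heq]
  refine (abs_add_le _ _).trans ?_
  have h7 := abs_add_le (∑ k ∈ S, A j k * u k) (∑ k ∈ Sᶜ, A j k * u k)
  rw [← hsplit] at h1 ⊢
  linarith

theorem IsSolution.norm_piecewise_step {N : ℕ} {A : ℝ → Matrix (Fin N) (Fin N) ℝ}
    (hA : IsAdjacency A) {x : ℝ → Fin N → ℝ} (hx : IsSolution A x) (S : Finset (Fin N))
    {C M t z : ℝ} (ht : 0 ≤ t) (htz : t ≤ z) (hC0 : 0 ≤ C)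
    (hC : ∀ s ∈ Set.Icc t z, ∀ j k, |A s j k| ≤ C) (hM : ∀ s ∈ Set.Icc t z, ‖x s‖ ≤ M)
    (hsmall : N * C * (z - t) ≤ 1) :
    ‖S.piecewise (x z) 0‖ ≤ ‖S.piecewise (x t) 0‖ + M * (∫ s in t..z, inWeight (A s) S) +
      (2 * N * C) ^ 2 * M * (z - t) ^ 2 := by
  have hz : 0 ≤ z := ht.trans htz
  have hh : 0 ≤ z - t := sub_nonneg.2 htz
  have hM0 : 0 ≤ M := (norm_nonneg _).trans (hM t ⟨le_rfl, htz⟩)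
  have hI := hA.intervalIntegrable_inWeight S ht hz
  have hI0 : 0 ≤ ∫ s in t..z, inWeight (A s) S :=
    intervalIntegral.integral_nonneg htz fun s _ => inWeight_nonneg _ _
  set p := ‖S.piecewise (x t) 0‖ with hp
  have hp0 : 0 ≤ p := norm_nonneg _
  have hosc : ∀ s ∈ Set.Icc t z, ‖x s - x t‖ ≤ 2 * N * C * M * (z - t) := by
    intro s hs
    rw [pi_norm_le_iff_of_nonneg (by positivity)]
    intro j
    rw [Pi.sub_apply, hx.eq_add_integral hA j ht (ht.trans hs.1), add_sub_cancel_left]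
    refine (intervalIntegral.norm_integral_le_of_norm_le_const (C := 2 * N * C * M)
      fun r hr => ?_).trans ?_
    · rw [Set.uIoc_of_le hs.1] at hr
      have hr' : r ∈ Set.Icc t z := ⟨hr.1.le, hr.2.trans hs.2⟩
      rw [norm_neg]
      exact (abs_sLap_mulVec_le _ (hA.2.2 r) (hC r hr') (x r) j).trans
        (mul_le_mul_of_nonneg_left (hM r hr') (by positivity))
    · rw [abs_of_nonneg (sub_nonneg.2 hs.1)]
      exact mul_le_mul_of_nonneg_left (by linarith [hs.2]) (by positivity)
  have hR : 0 ≤ p + M * (∫ s in t..z, inWeight (A s) S) + (2 * N * C) ^ 2 * M * (z - t) ^ 2 := by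
    positivity
  rw [pi_norm_le_iff_of_nonneg hR]
  intro j
  by_cases hj : j ∈ S
  swap
  · simpa [Finset.piecewise_eq_of_notMem _ _ _ hj] using hR
  rw [Finset.piecewise_eq_of_mem _ _ _ hj, Real.norm_eq_abs]
  have hpj : |x t j| ≤ p := by
    simpa [Finset.piecewise_eq_of_mem _ _ _ hj] using norm_le_pi_norm (S.piecewise (x t) 0) j
  have hxz : x z j = x t j * (1 - N * C * (z - t)) +
      ∫ s in t..z, (N * C * x t j + -((sLap (A s)).mulVec (x s) j)) := by
    rw [intervalIntegral.integral_add intervalIntegrable_const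
      (hx.intervalIntegrable hA j ht hz), intervalIntegral.integral_const,
      hx.eq_add_integral hA j ht hz, smul_eq_mul]
    ring
  have hint : |∫ s in t..z, (N * C * x t j + -((sLap (A s)).mulVec (x s) j))| ≤
      ∫ s in t..z, (N * C * p + (2 * N * C) * (2 * N * C * M * (z - t)) +
        M * inWeight (A s) S) := by
    rw [← Real.norm_eq_abs]
    refine intervalIntegral.norm_integral_le_of_norm_le htz (Eventually.of_forall fun s hs => ?_)
      ((intervalIntegrable_const (c := N * C * p + (2 * N * C) * (2 * N * C * M * (z - t)))).add
        (hI.const_mul M))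
    have hs' : s ∈ Set.Icc t z := ⟨hs.1.le, hs.2⟩
    have h1 := abs_sub_sLap_mulVec_le _ (hA.2.2 s) (hC s hs') hj (x t) (hM t ⟨le_rfl, htz⟩)
    have h2 := (abs_sLap_mulVec_le _ (hA.2.2 s) (hC s hs') (x s - x t) j).trans
      (mul_le_mul_of_nonneg_left (hosc s hs') (by positivity))
    have h3 : N * C * x t j + -((sLap (A s)).mulVec (x s) j) =
        (N * C * x t j - (sLap (A s)).mulVec (x t) j) -
          (sLap (A s)).mulVec (x s - x t) j := by
      rw [Matrix.mulVec_sub, Pi.sub_apply]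
      ring
    rw [Real.norm_eq_abs, h3]
    refine (abs_sub _ _).trans ?_
    linarith
  rw [intervalIntegral.integral_add intervalIntegrable_const (hI.const_mul M),
    intervalIntegral.integral_const, intervalIntegral.integral_const_mul, smul_eq_mul] at hint
  rw [hxz]
  refine (abs_add_le _ _).trans ?_
  rw [abs_mul, abs_of_nonneg (sub_nonneg.2 hsmall)]
  have := mul_le_mul_of_nonneg_right hpj (sub_nonneg.2 hsmall)
  linear_combination this + hint

theorem continuous_finset_piecewise_zero {ι : Type*} [Fintype ι] [DecidableEq ι] (S : Finset ι) :
    Continuous fun u : ι → ℝ => S.piecewise u 0 := by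
  refine continuous_pi fun j => ?_
  by_cases hj : j ∈ S
  · simpa [Finset.piecewise_eq_of_mem _ _ _ hj] using continuous_apply j
  · simpa [Finset.piecewise_eq_of_notMem _ _ _ hj] using continuous_const

theorem IsSolution.norm_piecewise_le {N : ℕ} {A : ℝ → Matrix (Fin N) (Fin N) ℝ}
    (hA : IsAdjacency A) {x : ℝ → Fin N → ℝ} (hx : IsSolution A x) (S : Finset (Fin N))
    {M t₀ T : ℝ} (ht₀ : 0 ≤ t₀) (hT : t₀ ≤ T) (hM : ∀ s ∈ Set.Icc t₀ T, ‖x s‖ ≤ M) :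
    ‖S.piecewise (x T) 0‖ ≤
      ‖S.piecewise (x t₀) 0‖ + M * ∫ s in t₀..T, inWeight (A s) S := by
  obtain ⟨C', hC'⟩ := hA.2.1 T
  set C := max C' 0
  have hC0 : 0 ≤ C := le_max_right _ _
  have hC : ∀ s ∈ Set.Icc 0 T, ∀ j k, |A s j k| ≤ C :=
    fun s hs j k => (hC' s hs j k).trans (le_max_left _ _)
  have hint : ∀ a b, 0 ≤ a → 0 ≤ b → IntervalIntegrable (fun s => inWeight (A s) S) volume a b :=
    fun a b ha hb => hA.intervalIntegrable_inWeight S ha hb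
  set f : ℝ → ℝ := fun t =>
    ‖S.piecewise (x t) 0‖ - M * ∫ s in t₀..t, inWeight (A s) S with hf
  have hfc : ContinuousOn f (Set.Icc t₀ T) := by
    refine ContinuousOn.sub ?_ (continuousOn_const.mul ?_)
    · exact ((continuous_finset_piecewise_zero S).comp_continuousOn
        (hx.1.mono fun s hs => ht₀.trans hs.1)).norm
    · have := intervalIntegral.continuousOn_primitive_interval' (hint t₀ T ht₀ (ht₀.trans hT))
        Set.left_mem_uIcc
      rwa [Set.uIcc_of_le hT] at this
  have key := image_le_of_liminf_slope_right_le_deriv_boundary hfc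
    (B := fun _ => ‖S.piecewise (x t₀) 0‖) (B' := fun _ => 0) (by simp [hf]) continuousOn_const
    (fun t _ => hasDerivWithinAt_const t _ _) (fun t ht r hr => by
      refine Eventually.frequently ?_
      set K := (2 * N * C) ^ 2 * M
      have e1 : ∀ᶠ z in 𝓝[>] t, z < T := nhdsWithin_le_nhds (eventually_lt_nhds ht.2)
      have e2 : ∀ᶠ z in 𝓝[>] t, N * C * (z - t) < 1 :=
        nhdsWithin_le_nhds <| (by fun_prop : Continuous fun z : ℝ => N * C * (z - t)).tendsto t
          |>.eventually_lt_const (by simp)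
      have e3 : ∀ᶠ z in 𝓝[>] t, K * (z - t) < r :=
        nhdsWithin_le_nhds <| (by fun_prop : Continuous fun z : ℝ => K * (z - t)).tendsto t
          |>.eventually_lt_const (by simpa using hr)
      filter_upwards [e1, e2, e3, self_mem_nhdsWithin] with z h1 h2 h3 hz
      have hz' : t < z := hz
      have ht0 : 0 ≤ t := ht₀.trans ht.1
      have hstep := hx.norm_piecewise_step hA S (C := C) (M := M) ht0 hz'.le hC0
        (fun s hs => hC s ⟨ht0.trans hs.1, hs.2.trans h1.le⟩)
        (fun s hs => hM s ⟨ht.1.trans hs.1, hs.2.trans h1.le⟩) h2.le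
      have hadd := intervalIntegral.integral_add_adjacent_intervals
        (hint t₀ t ht₀ ht0) (hint t z ht0 (ht0.trans hz'.le))
      have hpos : 0 < z - t := sub_pos.2 hz'
      rw [slope_def_field, div_lt_iff₀ hpos]
      have h4 := mul_lt_mul_of_pos_right h3 hpos
      simp only [hf]
      rw [← hadd]
      linear_combination hstep + h4)
  have := key ⟨hT, le_rfl⟩
  simp only [hf] at this
  linarith

/-- The supremum norm is nonincreasing along solutions. -/
theorem IsSolution.norm_le {N : ℕ} {A : ℝ → Matrix (Fin N) (Fin N) ℝ}
    (hA : IsAdjacency A) {x : ℝ → Fin N → ℝ} (hx : IsSolution A x)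
    {t₀ T : ℝ} (ht₀ : 0 ≤ t₀) (hT : t₀ ≤ T) : ‖x T‖ ≤ ‖x t₀‖ := by
  obtain ⟨M, hM⟩ := (isCompact_Icc (a := t₀) (b := T)).exists_bound_of_continuousOn
    (hx.1.mono (Set.Icc_subset_Ici_self.trans (Set.Ici_subset_Ici.2 ht₀)))
  simpa [inWeight] using hx.norm_piecewise_le hA univ ht₀ hT hM

theorem IsAdjacency.eventually_integral_inWeight_le {N : ℕ}
    {A : ℝ → Matrix (Fin N) (Fin N) ℝ} (hA : IsAdjacency A) {S : Finset (Fin N)}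
    (hS : ∀ j ∈ S, ∀ k ∈ Sᶜ, ¬ EssArc A j k) {ε : ℝ} (hε : 0 < ε) :
    ∀ᶠ t₀ in atTop, ∀ T, t₀ ≤ T → ∫ s in t₀..T, inWeight (A s) S ≤ ε := by
  have hint : IntegrableOn (fun s => inWeight (A s) S) (Set.Ioi 0) := by
    refine IntegrableOn.mono_set (t := Set.Ici 0) ?_ Set.Ioi_subset_Ici_self
    refine integrable_finsetSum _ fun j hj => integrable_finsetSum _ fun k hk => ?_
    refine ⟨(hA.1 j k).norm.aestronglyMeasurable, ?_⟩
    rw [hasFiniteIntegral_iff_norm]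
    simp only [Real.norm_eq_abs, abs_abs]
    exact lt_top_iff_ne_top.2 (hS j hj k hk)
  have hlim := intervalIntegral_tendsto_integral_Ioi 0 hint tendsto_id
  filter_upwards [hlim.eventually_const_lt (sub_lt_self _ hε), eventually_ge_atTop 0]
    with t₀ ht₀ h0 T hT
  have hadd := intervalIntegral.integral_add_adjacent_intervals
    (hA.intervalIntegrable_inWeight S le_rfl h0)
    (hA.intervalIntegrable_inWeight S h0 (h0.trans hT))
  have hle : ∫ s in (0:ℝ)..T, inWeight (A s) S ≤ ∫ s in Set.Ioi 0, inWeight (A s) S := by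
    rw [intervalIntegral.integral_of_le (h0.trans hT)]
    exact setIntegral_mono_set hint (Eventually.of_forall fun s => inWeight_nonneg _ _)
      (Set.Ioc_subset_Ioi_self).eventuallyLE
  simp only [id] at ht₀
  linarith

/-- A finite digraph without a root has two disjoint nonempty sets of nodes, neither of which
has an incoming arc. -/
theorem exists_disjoint_predecessor_closed {α : Type*} [Fintype α] [Nonempty α]
    (R : α → α → Prop) (h : ¬ ∃ r, ∀ j, Relation.ReflTransGen R r j) :
    ∃ S₁ S₂ : Finset α, S₁.Nonempty ∧ S₂.Nonempty ∧ Disjoint S₁ S₂ ∧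
      (∀ k j, R k j → j ∈ S₁ → k ∈ S₁) ∧ (∀ k j, R k j → j ∈ S₂ → k ∈ S₂) := by
  classical
  let reach : α → Finset α := fun r => univ.filter fun j => Relation.ReflTransGen R r j
  let anc : α → Finset α := fun j => univ.filter fun r => Relation.ReflTransGen R r j
  obtain ⟨r, -, hr⟩ := Finset.exists_max_image univ (fun r => (reach r).card) univ_nonempty
  push Not at h
  obtain ⟨j, hj⟩ := h r
  refine ⟨anc r, anc j, ⟨r, by simp [anc, Relation.ReflTransGen.refl]⟩,
    ⟨j, by simp [anc, Relation.ReflTransGen.refl]⟩, ?_, ?_, ?_⟩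
  · refine Finset.disjoint_left.2 fun w hw1 hw2 => ?_
    simp only [anc, mem_filter, mem_univ, true_and] at hw1 hw2
    have hss : reach r ⊂ reach w := by
      refine (Finset.ssubset_iff_of_subset fun i hi => ?_).2 ⟨j, by simpa [reach] using hw2,
        by simpa [reach] using hj⟩
      simp only [reach, mem_filter, mem_univ, true_and] at hi ⊢
      exact hw1.trans hi
    exact absurd (Finset.card_lt_card hss) (not_lt.2 (hr w (mem_univ w)))
  all_goals
    intro k i hki hi
    simp only [anc, mem_filter, mem_univ, true_and] at hi ⊢
    exact Relation.ReflTransGen.head hki hi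

/-- If a node set `S` receives total weight at most `ε` after `t₀` and a solution vanishes on `S`
at time `t₀`, then its bipartite consensus value is at most `‖x t₀‖ * ε`. -/
theorem IsSolution.abs_limit_le {N : ℕ} {A : ℝ → Matrix (Fin N) (Fin N) ℝ}
    (hA : IsAdjacency A) {x : ℝ → Fin N → ℝ} (hx : IsSolution A x) {S : Finset (Fin N)}
    {i : Fin N} (hi : i ∈ S) {t₀ ε M r c : ℝ} (ht₀ : 0 ≤ t₀)
    (hε : ∀ T, t₀ ≤ T → ∫ s in t₀..T, inWeight (A s) S ≤ ε)
    (hzero : ∀ j ∈ S, x t₀ j = 0) (hM : ‖x t₀‖ ≤ M) (hr : r = 1 ∨ r = -1)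
    (hlim : Tendsto (fun t => x t i) atTop (𝓝 (r * c))) : |c| ≤ M * ε := by
  have hM0 : 0 ≤ M := (norm_nonneg _).trans hM
  have hvanish : S.piecewise (x t₀) 0 = 0 := by
    ext j
    by_cases hj : j ∈ S
    · simp [Finset.piecewise_eq_of_mem _ _ _ hj, hzero j hj]
    · simp [Finset.piecewise_eq_of_notMem _ _ _ hj]
  have hc : |r * c| = |c| := by rcases hr with rfl | rfl <;> simp
  rw [← hc]
  refine le_of_tendsto hlim.abs ?_
  filter_upwards [eventually_ge_atTop t₀] with T hT
  have h := hx.norm_piecewise_le hA S ht₀ hT fun s hs => (hx.norm_le hA ht₀ hs.1).trans hM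
  rw [hvanish, norm_zero, zero_add] at h
  have h1 := norm_le_pi_norm (S.piecewise (x T) 0) i
  rw [Finset.piecewise_eq_of_mem _ _ _ hi, Real.norm_eq_abs] at h1
  exact (h1.trans h).trans (mul_le_mul_of_nonneg_left (hε T hT) hM0)

/-- bipartite consensus implies essential quasi-strong connectivity of the
graph of essential interactions. -/
theorem stmt13 {N : ℕ} (hN : 2 ≤ N) (A : ℝ → Matrix (Fin N) (Fin N) ℝ)
    (hA : IsAdjacency A) (hbc : BipartiteConsensus A) :
    ∃ r : Fin N, ∀ j : Fin N, EssReach A r j := by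
  by_contra hroot
  have : Nonempty (Fin N) := ⟨⟨0, by omega⟩⟩
  obtain ⟨S₁, S₂, ⟨i₁, hi₁⟩, ⟨i₂, hi₂⟩, hdisj, hS₁, hS₂⟩ :=
    exists_disjoint_predecessor_closed (fun k j => EssArc A j k) hroot
  obtain ⟨v, ρ, hv, hρ, hlim⟩ := hbc
  obtain ⟨i, hi⟩ := Function.ne_iff.1 hv
  obtain ⟨x, hx, hx0⟩ := hA.exists_isSolution (t₀ := 0) (Pi.single i (v i)⁻¹)
  have hvx : ∑ j, v j * x 0 j = 1 := by
    rw [hx0, Finset.sum_eq_single i (fun j _ hj => by simp [hj]) (by simp)]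
    simpa using mul_inv_cancel₀ hi
  have hxlim := hlim x hx
  have hbd : ∀ᶠ t in atTop, ‖x t‖ ≤ 2 := by
    have h : ∀ j, ∀ᶠ t in atTop, |x t j| < 2 := fun j =>
      (hxlim j).abs.eventually_lt_const (by
        rw [hvx]
        rcases hρ j with h | h <;> rw [h] <;> norm_num)
    filter_upwards [eventually_all.2 h] with t ht
    exact (pi_norm_le_iff_of_nonneg (by norm_num)).2 fun j => (ht j).le
  have hw₁ := hA.eventually_integral_inWeight_le (S := S₁)
    (fun j hj k hk h => mem_compl.1 hk (hS₁ k j h hj)) (by norm_num : (0:ℝ) < 1 / 10)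
  have hw₂ := hA.eventually_integral_inWeight_le (S := S₂)
    (fun j hj k hk h => mem_compl.1 hk (hS₂ k j h hj)) (by norm_num : (0:ℝ) < 1 / 10)
  obtain ⟨t₀, hnorm, hε₁, hε₂, ht₀⟩ :=
    (hbd.and (hw₁.and (hw₂.and (eventually_ge_atTop 0)))).exists
  obtain ⟨y, hy, hyt⟩ := hA.exists_isSolution (t₀ := t₀) (S₁.piecewise 0 (x t₀))
  obtain ⟨z, hz, hzt⟩ := hA.exists_isSolution (t₀ := t₀) (S₁.piecewise (x t₀) 0)
  have hcoord : ∀ j, |x t₀ j| ≤ 2 := fun j => (norm_le_pi_norm (x t₀) j).trans hnorm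
  have hynorm : ‖y t₀‖ ≤ 2 := by
    rw [hyt, pi_norm_le_iff_of_nonneg (by norm_num)]
    intro j
    by_cases hj : j ∈ S₁
    · simp [Finset.piecewise_eq_of_mem _ _ _ hj]
    · simpa [Finset.piecewise_eq_of_notMem _ _ _ hj] using hcoord j
  have hznorm : ‖z t₀‖ ≤ 2 := by
    rw [hzt, pi_norm_le_iff_of_nonneg (by norm_num)]
    intro j
    by_cases hj : j ∈ S₁
    · simpa [Finset.piecewise_eq_of_mem _ _ _ hj] using hcoord j
    · simp [Finset.piecewise_eq_of_notMem _ _ _ hj]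
  have hyc := hy.abs_limit_le hA hi₁ ht₀ hε₁
    (fun j hj => by rw [hyt, Finset.piecewise_eq_of_mem _ _ _ hj]; rfl) hynorm (hρ i₁)
    (hlim y hy i₁)
  have hzc := hz.abs_limit_le hA hi₂ ht₀ hε₂
    (fun j hj => by
      rw [hzt, Finset.piecewise_eq_of_notMem _ _ _ (Finset.disjoint_right.1 hdisj hj)]; rfl)
    hznorm (hρ i₂) (hlim z hz i₂)
  have hsum : (y + z + -x) t₀ = 0 := by
    ext j
    simp only [Pi.add_apply, Pi.neg_apply, hyt, hzt]
    by_cases hj : j ∈ S₁ <;> simp [hj]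
  have hu := (hy.add hA hz).add hA hx.neg
  have huc := hu.abs_limit_le hA hi₁ ht₀ hε₁ (fun j _ => by rw [hsum]; rfl)
    (by rw [hsum, norm_zero]) (hρ i₁) (hlim _ hu i₁)
  simp only [Pi.add_apply, Pi.neg_apply, mul_add, mul_neg, Finset.sum_add_distrib,
    Finset.sum_neg_distrib, hvx] at huc
  have h₁ := abs_le.1 hyc
  have h₂ := abs_le.1 hzc
  have h₃ := abs_le.1 huc
  linarith [h₁.2, h₂.2, h₃.1]
end

section
/- Assume the time-varying graph G[A(·)] is cut-balanced. Let x be a solution of ẋ(t) = −L[A(t)]x(t), set χ_i(t) = |x_i(t)| and θ_{ij}(t) = sgn(a_{ij}(t))sgn(x_i(t))sgn(x_j(t)), and let (k^1(t),…,k^N(t)) be a measurable ordering permutation for (χ_1(t),…,χ_N(t)) (so χ_{k^1(t)}(t) ≤ … ≤ χ_{k^N(t)}(t), M_j(t) := χ_{k^j(t)}(t) is locally Lipschitz and Ṁ_j(t) = χ̇_{k^j(t)}(t) a.e.). Define ã_{ji}(t) = a_{k^j(t)k^i(t)}(t), θ̃_{ji}(t) = θ_{k^j(t)k^i(t)}(t),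 and η̃_{ji}(t) = |ã_{ji}(t)|(θ̃_{ji}(t)M_i(t) − M_j(t)). Then η̃_{ji} ∈ L¹[0,∞) for all i,j, and consequently Ṁ_j ∈ L¹[0,∞) for every j. -/
open MeasureTheory Filter Matrix Finset Topology

theorem exists_nonneg_step_decomposition {N : ℕ} (hN : 0 < N) (M : Fin N → ℝ) (hM : Monotone M) :
    ∃ (c : ℝ) (g : Fin N → ℝ), (∀ m, 0 ≤ g m) ∧
      ∀ i, M i = c + ∑ m, g m * (if m < i then 1 else 0) := by
  let M' : ℕ → ℝ := fun n => M ⟨min n (N - 1), by omega⟩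
  refine ⟨M' 0, fun m => M' (m + 1) - M' m, fun m => ?_, fun i => ?_⟩
  · exact sub_nonneg.2 (hM (by simp only [Fin.mk_le_mk]; omega))
  · have h1 := Fin.sum_univ_eq_sum_range
      (fun m => (M' (m + 1) - M' m) * (if m < (i : ℕ) then (1 : ℝ) else 0)) N
    simp only [Fin.lt_def]
    rw [h1]
    simp only [mul_ite, mul_one, mul_zero]
    rw [← Finset.sum_filter]
    have h2 : (Finset.range N).filter (fun m => m < (i : ℕ)) = Finset.range i := by
      ext m
      simp only [Finset.mem_filter, Finset.mem_range]
      omega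
    rw [h2, Finset.sum_range_sub]
    have h3 : M' i = M i := by
      simp only [M']
      congr 1
      ext
      simp only
      omega
    rw [h3]
    ring

/-- Weighted dissipation inequality for the indicator of an upper cut. -/
theorem cut_dissipation {N : ℕ} {K : ℝ} (hK : 1 ≤ K) (b : Fin N → Fin N → ℝ)
    (hb : ∀ j i, 0 ≤ b j i)
    (hcut : ∀ V : Finset (Fin N), V.Nonempty → V ≠ Finset.univ →
      (∑ j ∈ V, ∑ k ∈ Vᶜ, b k j) ≤ K * (∑ j ∈ V, ∑ k ∈ Vᶜ, b j k)) (m : Fin N)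
    (e : Fin N → ℝ) (he : ∀ i, e i = if m < i then 1 else 0) :
    ∑ j : Fin N, ∑ i, (2 * K + 1) ^ (j : ℕ) * (b j i * (e i - e j)) ≤
      -∑ j, ∑ i, b j i * |e i - e j| := by
  set L := 2 * K + 1 with hL
  have hL1 : 1 ≤ L := by linarith
  set U : Finset (Fin N) := Finset.univ.filter (fun i => m < i) with hU
  have hP : ∑ j, ∑ i, b j i * ((1 - e j) * e i) = ∑ j ∈ U, ∑ k ∈ Uᶜ, b k j := by
    rw [Finset.sum_comm, hU, Finset.sum_filter]
    refine Finset.sum_congr rfl fun i _ => ?_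
    rw [Finset.compl_filter, Finset.sum_filter]
    by_cases h : m < i
    · simp only [h, if_true]
      refine Finset.sum_congr rfl fun j _ => ?_
      by_cases h' : m < j <;> simp [he, h, h']
    · simp [he, h]
  have hQ : ∑ j, ∑ i, b j i * (e j * (1 - e i)) = ∑ j ∈ U, ∑ k ∈ Uᶜ, b j k := by
    rw [hU, Finset.sum_filter]
    refine Finset.sum_congr rfl fun i _ => ?_
    rw [Finset.compl_filter, Finset.sum_filter]
    by_cases h : m < i
    · simp only [h, if_true]
      refine Finset.sum_congr rfl fun j _ => ?_
      by_cases h' : m < j <;> simp [he, h, h']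
    · simp [he, h]
  have hPQ : ∑ j, ∑ i, b j i * ((1 - e j) * e i) ≤ K * ∑ j, ∑ i, b j i * (e j * (1 - e i)) := by
    rw [hP, hQ]
    rcases U.eq_empty_or_nonempty with h | h
    · simp [h]
    · refine hcut U h fun h' => ?_
      have : m ∈ U := h' ▸ Finset.mem_univ m
      simp [hU] at this
  have habs : ∑ j, ∑ i, b j i * |e i - e j| =
      ∑ j, ∑ i, b j i * ((1 - e j) * e i) + ∑ j, ∑ i, b j i * (e j * (1 - e i)) := by
    simp only [← Finset.sum_add_distrib]
    refine Finset.sum_congr rfl fun j _ => Finset.sum_congr rfl fun i _ => ?_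
    rw [he i, he j]
    split_ifs <;> simp
  have hP0 : 0 ≤ ∑ j, ∑ i, b j i * ((1 - e j) * e i) :=
    Finset.sum_nonneg fun j _ => Finset.sum_nonneg fun i _ => by
      rw [he i, he j]
      have := hb j i
      split_ifs <;> simp [this]
  have hle : ∑ j : Fin N, ∑ i, L ^ (j : ℕ) * (b j i * (e i - e j)) ≤
      L ^ (m : ℕ) * ∑ j, ∑ i, b j i * ((1 - e j) * e i) -
        L ^ (m + 1 : ℕ) * ∑ j, ∑ i, b j i * (e j * (1 - e i)) := by
    simp only [Finset.mul_sum, ← Finset.sum_sub_distrib]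
    refine Finset.sum_le_sum fun j _ => Finset.sum_le_sum fun i _ => ?_
    rw [he i, he j]
    have hbji := hb j i
    by_cases hj : m < j
    · have : L ^ (m + 1 : ℕ) ≤ L ^ (j : ℕ) := pow_le_pow_right₀ hL1 hj
      by_cases hi : m < i
      · simp [hi, hj]
      · simp only [hi, hj, if_true, if_false]
        nlinarith
    · have : L ^ (j : ℕ) ≤ L ^ (m : ℕ) := pow_le_pow_right₀ hL1 (not_lt.1 hj)
      by_cases hi : m < i
      · simp only [hi, hj, if_true, if_false]
        nlinarith
      · simp [hi, hj]
  refine hle.trans ?_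
  rw [habs, pow_succ]
  set P := ∑ j, ∑ i, b j i * ((1 - e j) * e i)
  set Q := ∑ j, ∑ i, b j i * (e j * (1 - e i))
  have hLm : 1 ≤ L ^ (m : ℕ) := one_le_pow₀ hL1
  have h2 : P + (P + Q) ≤ L * Q := by rw [hL]; linarith
  have hQ0 : 0 ≤ Q := by nlinarith
  nlinarith

theorem monotone_dissipation {N : ℕ} {K : ℝ} (hK : 1 ≤ K) (b : Fin N → Fin N → ℝ)
    (hb : ∀ j i, 0 ≤ b j i)
    (hcut : ∀ V : Finset (Fin N), V.Nonempty → V ≠ Finset.univ →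
      (∑ j ∈ V, ∑ k ∈ Vᶜ, b k j) ≤ K * (∑ j ∈ V, ∑ k ∈ Vᶜ, b j k))
    (M : Fin N → ℝ) (hM : Monotone M) :
    ∑ j : Fin N, ∑ i, (2 * K + 1) ^ (j : ℕ) * (b j i * (M i - M j)) ≤
      -∑ j, ∑ i, b j i * |M i - M j| := by
  rcases Nat.eq_zero_or_pos N with rfl | hN
  · simp
  obtain ⟨c, g, hg, hM'⟩ := exists_nonneg_step_decomposition hN M hM
  set e : Fin N → Fin N → ℝ := fun m i => if m < i then 1 else 0 with he
  have hdiff : ∀ i j, M i - M j = ∑ m, g m * (e m i - e m j) := fun i j => by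
    rw [hM' i, hM' j]
    simp only [he, mul_sub, Finset.sum_sub_distrib]
    ring
  have habs : ∀ i j, |M i - M j| ≤ ∑ m, g m * |e m i - e m j| := fun i j => by
    rw [hdiff]
    refine (Finset.abs_sum_le_sum_abs _ _).trans (Finset.sum_le_sum fun m _ => ?_)
    rw [abs_mul, abs_of_nonneg (hg m)]
  have hswap : ∀ f : Fin N → Fin N → Fin N → ℝ,
      ∑ m, ∑ j, ∑ i, f m j i = ∑ j, ∑ i, ∑ m, f m j i := fun f => by
    rw [Finset.sum_comm]
    exact Finset.sum_congr rfl fun j _ => Finset.sum_comm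
  have hcuts := Finset.sum_le_sum fun m (_ : m ∈ Finset.univ) =>
    mul_le_mul_of_nonneg_left (cut_dissipation hK b hb hcut m (e m) fun _ => rfl) (hg m)
  simp only [Finset.mul_sum, mul_neg, Finset.sum_neg_distrib] at hcuts
  rw [hswap fun m j i => g m * ((2 * K + 1) ^ (j : ℕ) * (b j i * (e m i - e m j))),
    hswap fun m j i => g m * (b j i * |e m i - e m j|)] at hcuts
  calc _ = ∑ j : Fin N, ∑ i, ∑ m, g m * ((2 * K + 1) ^ (j : ℕ) * (b j i * (e m i - e m j))) := by
        refine Finset.sum_congr rfl fun j _ => Finset.sum_congr rfl fun i _ => ?_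
        rw [hdiff, Finset.mul_sum, Finset.mul_sum]
        exact Finset.sum_congr rfl fun m _ => by ring
    _ ≤ -∑ j, ∑ i, ∑ m, g m * (b j i * |e m i - e m j|) := hcuts
    _ ≤ _ := by
        refine neg_le_neg (Finset.sum_le_sum fun j _ => Finset.sum_le_sum fun i _ => ?_)
        refine (mul_le_mul_of_nonneg_left (habs i j) (hb j i)).trans_eq ?_
        rw [Finset.mul_sum]
        exact Finset.sum_congr rfl fun m _ => by ring

theorem signed_dissipation {N : ℕ} {K : ℝ} (hK : 1 ≤ K) (b θ : Fin N → Fin N → ℝ)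
    (hb : ∀ j i, 0 ≤ b j i) (hθ : ∀ j i, θ j i ≤ 1)
    (hcut : ∀ V : Finset (Fin N), V.Nonempty → V ≠ Finset.univ →
      (∑ j ∈ V, ∑ k ∈ Vᶜ, b k j) ≤ K * (∑ j ∈ V, ∑ k ∈ Vᶜ, b j k))
    (M : Fin N → ℝ) (hM : Monotone M) (hM0 : ∀ i, 0 ≤ M i) :
    ∑ j, ∑ i, |b j i * (θ j i * M i - M j)| ≤
      -∑ j : Fin N, (2 * K + 1) ^ (j : ℕ) * ∑ i, b j i * (θ j i * M i - M j) := by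
  have h := monotone_dissipation hK b hb hcut M hM
  have hpt : ∀ j i, |b j i * (θ j i * M i - M j)| +
      (2 * K + 1) ^ (j : ℕ) * (b j i * (θ j i * M i - M j)) ≤
      b j i * |M i - M j| + (2 * K + 1) ^ (j : ℕ) * (b j i * (M i - M j)) := fun j i => by
    have hL : 1 ≤ (2 * K + 1) ^ (j : ℕ) := one_le_pow₀ (by linarith)
    have hs : 0 ≤ b j i * ((1 - θ j i) * M i) :=
      mul_nonneg (hb j i) (mul_nonneg (sub_nonneg.2 (hθ j i)) (hM0 i))
    have hsplit : b j i * (θ j i * M i - M j) =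
        b j i * (M i - M j) - b j i * ((1 - θ j i) * M i) := by ring
    have habs := abs_sub (b j i * (M i - M j)) (b j i * ((1 - θ j i) * M i))
    rw [abs_mul, abs_of_nonneg (hb j i), abs_of_nonneg hs] at habs
    rw [hsplit]
    nlinarith
  have hsum := Finset.sum_le_sum fun j (_ : j ∈ Finset.univ) =>
    Finset.sum_le_sum fun i (_ : i ∈ Finset.univ) => hpt j i
  simp only [Finset.sum_add_distrib] at hsum
  simp only [Finset.mul_sum]
  linarith

theorem Real.measurable_sign : Measurable Real.sign :=
  Measurable.ite measurableSet_Iio measurable_const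
    (Measurable.ite measurableSet_Ioi measurable_const measurable_const)

theorem Real.abs_sign_le_one (r : ℝ) : |Real.sign r| ≤ 1 := by
  rcases Real.sign_apply_eq r with h | h | h <;> simp [h]

theorem Measurable.apply_of_countable {α ι β : Type*} [MeasurableSpace α] [MeasurableSpace ι]
    [MeasurableSpace β] [Countable ι] [MeasurableSingletonClass ι] {F : ι → α → β} {s : α → ι}
    (hF : ∀ i, Measurable (F i)) (hs : Measurable s) : Measurable fun t => F (s t) t :=
  (measurable_from_prod_countable_right (f := fun p : ι × α => F p.1 p.2) hF).comp
    (hs.prodMk measurable_id)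

theorem HasDerivAt.eq_sign_mul_of_abs {f : ℝ → ℝ} {t d d' : ℝ} (hf : HasDerivAt f d' t)
    (habs : HasDerivAt (fun s => |f s|) d t) : d = Real.sign (f t) * d' := by
  rcases lt_trichotomy (f t) 0 with h | h | h
  · have hev : (fun s => |f s|) =ᶠ[𝓝 t] fun s => -f s := by
      filter_upwards [hf.continuousAt.eventually_lt_const h] with s hs
      exact abs_of_neg hs
    rw [Real.sign_of_neg h, habs.unique (hf.neg.congr_of_eventuallyEq hev)]
    ring
  · have hmin : IsLocalMin (fun s => |f s|) t := by
      refine Filter.Eventually.of_forall fun s => ?_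
      simp [h]
    rw [hmin.hasDerivAt_eq_zero habs, h, Real.sign_zero, zero_mul]
  · have hev : (fun s => |f s|) =ᶠ[𝓝 t] f := by
      filter_upwards [hf.continuousAt.eventually_const_lt h] with s hs
      exact abs_of_pos hs
    rw [Real.sign_of_pos h, habs.unique (hf.congr_of_eventuallyEq hev), one_mul]

theorem IsAdjacency.integrableOn_sLap {N : ℕ} {A : ℝ → Matrix (Fin N) (Fin N) ℝ}
    (hA : IsAdjacency A) (T : ℝ) (j k : Fin N) :
    IntegrableOn (fun s => sLap (A s) j k) (Set.Icc 0 T) := by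
  obtain ⟨hmeas, hbdd, -⟩ := hA
  obtain ⟨C, hC⟩ := hbdd T
  have hint : ∀ k, IntegrableOn (fun s => A s j k) (Set.Icc 0 T) := fun k =>
    Measure.integrableOn_of_bounded (M := C) (by simp) (hmeas j k).aestronglyMeasurable
      ((ae_restrict_iff' measurableSet_Icc).2 (Eventually.of_forall fun s hs => hC s hs j k))
  by_cases h : j = k
  · simp only [sLap, h, if_true]
    exact h ▸ integrable_finsetSum _ fun m _ => (hint m).abs
  · simp only [sLap, h, if_false]
    exact (hint k).neg

theorem IsSolution.ae_hasDerivAt {N : ℕ} {A : ℝ → Matrix (Fin N) (Fin N) ℝ}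
    (hA : IsAdjacency A) {x : ℝ → Fin N → ℝ} (hx : IsSolution A x) :
    ∀ᵐ t ∂(volume.restrict (Set.Ici (0 : ℝ))), ∀ j,
      HasDerivAt (fun s => x s j) (-((sLap (A t)).mulVec (x t) j)) t := by
  have hint : ∀ (j : Fin N) (n : ℕ),
      IntervalIntegrable (fun s => -((sLap (A s)).mulVec (x s) j)) volume 0 n := fun j n => by
    rw [intervalIntegrable_iff_integrableOn_Icc_of_le n.cast_nonneg]
    refine Integrable.neg ?_
    simp only [Matrix.mulVec, dotProduct]
    refine integrable_finsetSum _ fun k _ => ?_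
    exact (hA.integrableOn_sLap n j k).mul_continuousOn
      (((continuous_apply k).comp_continuousOn hx.1).mono Set.Icc_subset_Ici_self) isCompact_Icc
  have hall : ∀ᵐ t : ℝ, ∀ (j : Fin N) (n : ℕ), t ∈ Set.uIcc (0 : ℝ) n →
      ∀ c ∈ Set.uIcc (0 : ℝ) n,
      HasDerivAt (fun u => ∫ s in c..u, -((sLap (A s)).mulVec (x s) j))
        (-((sLap (A t)).mulVec (x t) j)) t :=
    ae_all_iff.2 fun j => ae_all_iff.2 fun n => (hint j n).ae_hasDerivAt_integral
  rw [← restrict_Ioi_eq_restrict_Ici, ae_restrict_iff' measurableSet_Ioi]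
  filter_upwards [hall] with t ht ht0 j
  obtain ⟨n, hn⟩ := exists_nat_ge t
  have ht0' : 0 < t := ht0
  have h := (ht j n (Set.mem_uIcc_of_le ht0'.le hn) 0 Set.left_mem_uIcc).const_add (x 0 j)
  refine h.congr_of_eventuallyEq ?_
  filter_upwards [Ioi_mem_nhds ht0'] with s hs
  exact hx.2 s (Set.mem_Ici.2 (le_of_lt hs)) j

theorem sign_mul_neg_sLap_mulVec {N : ℕ} (B : Matrix (Fin N) (Fin N) ℝ) (hB : ∀ j, B j j = 0)
    (v : Fin N → ℝ) (j : Fin N) :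
    Real.sign (v j) * -((sLap B).mulVec v j) =
      ∑ k, |B j k| * ((Real.sign (B j k) * Real.sign (v j) * Real.sign (v k)) * |v k| - |v j|) := by
  have habs : ∀ r : ℝ, Real.sign r * |r| = r := fun r => by
    rcases lt_trichotomy r 0 with h | h | h
    · rw [Real.sign_of_neg h, abs_of_neg h]; ring
    · simp [h]
    · rw [Real.sign_of_pos h, abs_of_pos h]; ring
  have habs' : ∀ r : ℝ, Real.sign r * r = |r| := fun r => by
    rcases lt_trichotomy r 0 with h | h | h
    · rw [Real.sign_of_neg h, abs_of_neg h]; ring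
    · simp [h]
    · rw [Real.sign_of_pos h, abs_of_pos h]; ring
  have hmul : (sLap B).mulVec v j = (∑ m, |B j m|) * v j - ∑ k, B j k * v k := by
    have hterm : ∀ k, sLap B j k * v k =
        (if j = k then (∑ m, |B j m|) * v k else 0) - B j k * v k := fun k => by
      by_cases h : j = k
      · subst h; simp [sLap, hB]
      · simp [sLap, h]
    simp only [Matrix.mulVec, dotProduct, hterm, Finset.sum_sub_distrib, Finset.sum_ite_eq,
      Finset.mem_univ, if_true]
  rw [hmul, neg_sub, mul_sub, ← mul_assoc, mul_comm (Real.sign (v j)) (∑ m, |B j m|), mul_assoc,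
    habs', Finset.mul_sum, Finset.sum_mul, ← Finset.sum_sub_distrib]
  refine Finset.sum_congr rfl fun k _ => ?_
  calc Real.sign (v j) * (B j k * v k) - |B j k| * |v j|
      = Real.sign (v j) * ((Real.sign (B j k) * |B j k|) * (Real.sign (v k) * |v k|))
          - |B j k| * |v j| := by rw [habs, habs]
    _ = _ := by ring

theorem sum_cut_comp_bijective {N : ℕ} {τ : Fin N → Fin N} (hτ : Function.Bijective τ)
    (f : Fin N → Fin N → ℝ) (V : Finset (Fin N)) :
    ∑ j ∈ V.image τ, ∑ k ∈ (V.image τ)ᶜ, f j k = ∑ j ∈ V, ∑ k ∈ Vᶜ, f (τ j) (τ k) := by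
  have hc : (V.image τ)ᶜ = Vᶜ.image τ := by
    apply Finset.coe_injective
    simpa using (Set.image_compl_eq (s := (V : Set (Fin N))) hτ).symm
  rw [hc, Finset.sum_image hτ.1.injOn]
  exact Finset.sum_congr rfl fun j _ => Finset.sum_image hτ.1.injOn

theorem integrableOn_of_forall_norm_le_of_integral_le {f D : ℝ → ℝ} {I : ℝ}
    (hf : AEStronglyMeasurable f (volume.restrict (Set.Ici 0)))
    (hfD : ∀ᵐ t ∂(volume.restrict (Set.Ici (0 : ℝ))), ‖f t‖ ≤ D t)
    (hD : ∀ n : ℕ, IntervalIntegrable D volume 0 n)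
    (hI : ∀ n : ℕ, ∫ t in (0 : ℝ)..n, D t ≤ I) : IntegrableOn f (Set.Ici 0) := by
  rw [integrableOn_Ici_iff_integrableOn_Ioi]
  have hsub : ∀ n : ℕ, Set.Ioc (0 : ℝ) n ⊆ Set.Ici 0 := fun n t ht => le_of_lt ht.1
  have hfi : ∀ n : ℕ, IntegrableOn f (Set.Ioc 0 n) := fun n =>
    Integrable.mono' (hD n).1 (hf.mono_set (hsub n))
      (ae_restrict_of_ae_restrict_of_subset (hsub n) hfD)
  refine integrableOn_Ioi_of_intervalIntegral_norm_bounded (b := fun n : ℕ => (n : ℝ)) I 0 hfi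
    tendsto_natCast_atTop_atTop (Eventually.of_forall fun n => le_trans ?_ (hI n))
  rw [intervalIntegral.integral_of_le n.cast_nonneg, intervalIntegral.integral_of_le n.cast_nonneg]
  exact integral_mono_ae (hfi n).norm (hD n).1
    (ae_restrict_of_ae_restrict_of_subset (hsub n) hfD)

/-- for a cut-balanced graph and a measurable ordering permutation `σ` of the
moduli `χ_i = |x_i|` (with sorted functions `M_j(t) = |x_{σ(t)j}(t)|` locally Lipschitz and
`Ṁ_j = χ̇_{σ(t)j}` a.e.), the functions
`η̃_{ji} = |ã_{ji}| (θ̃_{ji} M_i − M_j)` are in `L¹[0,∞)`, and so are the `Ṁ_j`. -/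
theorem stmt14 {N : ℕ} (hN : 2 ≤ N) (A : ℝ → Matrix (Fin N) (Fin N) ℝ)
    (hA : IsAdjacency A) (hCB : CutBalanced A)
    (x : ℝ → Fin N → ℝ) (hx : IsSolution A x)
    (σ : ℝ → Fin N → Fin N)
    (hbij : ∀ t, Function.Bijective (σ t))
    (hmeas : ∀ j, Measurable fun t => σ t j)
    (hsort : ∀ t ∈ Set.Ici (0:ℝ), ∀ j j' : Fin N, j ≤ j' → |x t (σ t j)| ≤ |x t (σ t j')|)
    (hlip : ∀ j : Fin N, ∀ a b : ℝ, 0 ≤ a →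
      ∃ L : NNReal, LipschitzOnWith L (fun t => |x t (σ t j)|) (Set.Icc a b))
    (hder : ∀ᵐ t ∂(volume.restrict (Set.Ici (0:ℝ))), ∀ j : Fin N, ∃ d : ℝ,
      HasDerivAt (fun s => |x s (σ s j)|) d t ∧ HasDerivAt (fun s => |x s (σ t j)|) d t) :
    (∀ j i : Fin N, IntegrableOn
      (fun t => |A t (σ t j) (σ t i)| *
        ((Real.sign (A t (σ t j) (σ t i)) * Real.sign (x t (σ t j)) * Real.sign (x t (σ t i)))
            * |x t (σ t i)| - |x t (σ t j)|))
      (Set.Ici (0:ℝ))) ∧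
    (∀ j : Fin N, IntegrableOn (deriv fun t => |x t (σ t j)|) (Set.Ici (0:ℝ))) := by
  obtain ⟨K, hK, hcut⟩ := hCB
  set η : Fin N → Fin N → ℝ → ℝ := fun j i t => |A t (σ t j) (σ t i)| *
    ((Real.sign (A t (σ t j) (σ t i)) * Real.sign (x t (σ t j)) * Real.sign (x t (σ t i)))
      * |x t (σ t i)| - |x t (σ t j)|) with hη
  set M : Fin N → ℝ → ℝ := fun j t => |x t (σ t j)| with hMdef
  have hderiv : ∀ᵐ t ∂(volume.restrict (Set.Ici (0 : ℝ))), ∀ j, deriv (M j) t = ∑ i, η j i t := by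
    filter_upwards [hder, hx.ae_hasDerivAt hA] with t ht hxt j
    obtain ⟨d, hd, hd'⟩ := ht j
    rw [hd.deriv, (hxt (σ t j)).eq_sign_mul_of_abs hd', sign_mul_neg_sLap_mulVec _ (hA.2.2 t)]
    exact ((hbij t).sum_comp fun k => |A t (σ t j) k| *
      ((Real.sign (A t (σ t j) k) * Real.sign (x t (σ t j)) * Real.sign (x t k)) * |x t k|
        - |x t (σ t j)|)).symm
  have hbound : ∀ᵐ t ∂(volume.restrict (Set.Ici (0 : ℝ))), ∀ j i,
      ‖η j i t‖ ≤ -∑ j : Fin N, (2 * K + 1) ^ (j : ℕ) * deriv (M j) t := by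
    filter_upwards [hderiv, hcut, ae_restrict_mem measurableSet_Ici] with t ht hc ht0 j i
    simp only [ht]
    have hdiss := signed_dissipation hK (fun j i => |A t (σ t j) (σ t i)|)
      (fun j i => Real.sign (A t (σ t j) (σ t i)) * Real.sign (x t (σ t j)) *
        Real.sign (x t (σ t i)))
      (fun _ _ => abs_nonneg _)
      (fun j i => (le_abs_self _).trans <| by
        rw [abs_mul, abs_mul]
        exact mul_le_one₀ (mul_le_one₀ (Real.abs_sign_le_one _) (abs_nonneg _)
          (Real.abs_sign_le_one _)) (abs_nonneg _) (Real.abs_sign_le_one _))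
      (fun V hV hV' => by
        have h := (hc (V.image (σ t)) (hV.image _) fun h => hV' <| by
          rw [← Finset.image_univ_of_surjective (hbij t).2] at h
          exact Finset.image_injective (hbij t).1 h).1
        rw [sum_cut_comp_bijective (hbij t) fun j k => |A t k j|,
          sum_cut_comp_bijective (hbij t) fun j k => |A t j k|] at h
        exact (inv_mul_le_iff₀ (by linarith)).1 h)
      (fun j => M j t) (fun j j' h => hsort t ht0 j j' h) (fun _ => abs_nonneg _)
    refine le_trans ?_ hdiss
    refine le_trans ?_ (Finset.single_le_sum
      (fun j _ => Finset.sum_nonneg fun i _ => abs_nonneg _) (Finset.mem_univ j))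
    exact Finset.single_le_sum (f := fun i => |η j i t|)
      (fun i _ => abs_nonneg _) (Finset.mem_univ i)
  have hAC : ∀ (j : Fin N) (n : ℕ), AbsolutelyContinuousOnInterval (M j) 0 n := fun j n => by
    obtain ⟨C, hC⟩ := hlip j 0 n le_rfl
    rw [← Set.uIcc_of_le n.cast_nonneg] at hC
    exact hC.absolutelyContinuousOnInterval
  have hDint : ∀ (n : ℕ) (j : Fin N),
      IntervalIntegrable (fun t => (2 * K + 1) ^ (j : ℕ) * deriv (M j) t) volume 0 n :=
    fun n j => (hAC j n).intervalIntegrable_deriv.const_mul _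
  have hηmeas : ∀ j i, AEStronglyMeasurable (η j i) (volume.restrict (Set.Ici 0)) := fun j i => by
    have hy : Continuous fun t => x (max t 0) :=
      hx.1.comp_continuous (by fun_prop) fun t => le_max_right t 0
    have hxm : ∀ j, Measurable fun t => x (max t 0) (σ t j) := fun j =>
      Measurable.apply_of_countable (F := fun k t => x (max t 0) k)
        (fun k => ((continuous_apply k).comp hy).measurable) (hmeas j)
    have hAm : Measurable fun t => A t (σ t j) (σ t i) :=
      Measurable.apply_of_countable (F := fun (p : Fin N × Fin N) t => A t p.1 p.2)
        (fun p => hA.1 p.1 p.2) ((hmeas j).prodMk (hmeas i))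
    have hm : Measurable fun t => |A t (σ t j) (σ t i)| *
        ((Real.sign (A t (σ t j) (σ t i)) * Real.sign (x (max t 0) (σ t j)) *
          Real.sign (x (max t 0) (σ t i))) * |x (max t 0) (σ t i)| - |x (max t 0) (σ t j)|) :=
      hAm.abs.mul (((((Real.measurable_sign.comp hAm).mul (Real.measurable_sign.comp (hxm j))).mul
        (Real.measurable_sign.comp (hxm i))).mul (hxm i).abs).sub (hxm j).abs)
    refine hm.aestronglyMeasurable.congr ?_
    filter_upwards [ae_restrict_mem measurableSet_Ici] with t ht
    simp only [hη, max_eq_left (Set.mem_Ici.1 ht)]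
  have hηint : ∀ j i, IntegrableOn (η j i) (Set.Ici 0) := fun j i => by
    refine integrableOn_of_forall_norm_le_of_integral_le
      (I := ∑ j : Fin N, (2 * K + 1) ^ (j : ℕ) * M j 0) (hηmeas j i)
      (hbound.mono fun t ht => ht j i)
      (fun n => (IntervalIntegrable.sum Finset.univ fun j _ => hDint n j).neg.congr ?_)
      fun n => ?_
    · exact fun t _ => by simp
    · rw [intervalIntegral.integral_neg, intervalIntegral.integral_finsetSum fun j _ => hDint n j,
        ← Finset.sum_neg_distrib]
      refine Finset.sum_le_sum fun j _ => ?_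
      rw [intervalIntegral.integral_const_mul, (hAC j n).integral_deriv_eq_sub]
      have hMn : 0 ≤ M j n := abs_nonneg _
      have hL : 0 < (2 * K + 1) ^ (j : ℕ) := pow_pos (by linarith) _
      nlinarith
  refine ⟨hηint, fun j => ?_⟩
  exact (integrable_finsetSum Finset.univ fun i _ => hηint j i).congr
    (hderiv.mono fun t ht => (ht j).symm)
end
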